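/- arXiv:2110.11758 — 2 statements merged into one kernel-verified Lean document; each statement's English description precedes it below -/
import Mathlib

section
/- A Crew instance in which every card has value 1 (k = 1) admits a successful play sequence if and only if either O is empty, or there is a single player i to whom all objectives in O are assigned and min over players j of |C_j| is at least max over players j of the number of cards in C_j that are the card of some objective in O. -/
/-- A card is a pair (value, suit). -/
abbrev Card : Type := ℕ × ℕ

/-- A trick from state `st` led by `lead` with plays `play` is legal:
every hand is nonempty, each player plays a card from their own hand,
and every player follows the led suit if able. -/
def TrickOk {p : ℕ} (st : Fin p → Finset Card) (lead : Fin p) (play : Fin p → Card) : Prop :=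
  (∀ i, (st i).Nonempty) ∧ (∀ i, play i ∈ st i) ∧
  (∀ i, (play i).2 = (play lead).2 ∨ ∀ c ∈ st i, c.2 ≠ (play lead).2)

/-- Player `w` wins the trick: `w`'s card is of the led suit and strictly
beats every other card of the led suit. -/
def Wins {p : ℕ} (lead : Fin p) (play : Fin p → Card) (w : Fin p) : Prop :=
  (play w).2 = (play lead).2 ∧
  ∀ j, j ≠ w → (play j).2 = (play lead).2 → (play j).1 < (play w).1

/-- A played trick: its leader, the card played by each player, and its winner. -/
structure Trick (p : ℕ) where
  lead : Fin p
  play : Fin p → Card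
  winner : Fin p

/-- After a trick, each played card is removed from its owner's hand. -/
def nextState {p : ℕ} (st : Fin p → Finset Card) (play : Fin p → Card) :
    Fin p → Finset Card :=
  fun i => (st i).erase (play i)

/-- `PlaysFrom st lead L fin`: starting from hands `st` with `lead` to lead the
first trick, the list of tricks `L` is a legal play sequence ending in hands `fin`;
the winner of each trick leads the next. -/
inductive PlaysFrom {p : ℕ} :
    (Fin p → Finset Card) → Fin p → List (Trick p) → (Fin p → Finset Card) → Prop
  | nil (st : Fin p → Finset Card) (lead : Fin p) : PlaysFrom st lead [] st
  | cons {st : Fin p → Finset Card} {lead : Fin p} {play : Fin p → Card} {w : Fin p}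
      {rest : List (Trick p)} {fin : Fin p → Finset Card} :
      TrickOk st lead play → Wins lead play w →
      PlaysFrom (nextState st play) w rest fin →
      PlaysFrom st lead (⟨lead, play, w⟩ :: rest) fin

/-- Objective `o = (c, i)` is completed in trick `t` if card `c` is played in `t`
and player `i` wins `t`. -/
def Completes {p : ℕ} (t : Trick p) (o : Card × Fin p) : Prop :=
  (∃ j, t.play j = o.1) ∧ t.winner = o.2

instance {p : ℕ} (t : Trick p) (o : Card × Fin p) : Decidable (Completes t o) :=
  inferInstanceAs (Decidable ((∃ j, t.play j = o.1) ∧ t.winner = o.2))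

/-- A play sequence is successful if every objective is completed in some trick. -/
def Successful {p : ℕ} (O : Finset (Card × Fin p)) (L : List (Trick p)) : Prop :=
  ∀ o ∈ O, ∃ t ∈ L, Completes t o

/-- The structural conditions on a Crew instance: hands are pairwise disjoint
(cards are distinct), every objective card is in some hand, and no two
objectives share a card. -/
def ValidInstance {p : ℕ} (hand : Fin p → Finset Card) (O : Finset (Card × Fin p)) : Prop :=
  (∀ i j : Fin p, i ≠ j → Disjoint (hand i) (hand j)) ∧
  (∀ o ∈ O, ∃ i, o.1 ∈ hand i) ∧
  (∀ o ∈ O, ∀ q ∈ O, o.1 = q.1 → o = q)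

/-- The instance admits a successful play sequence (with an arbitrary first leader). -/
def HasSuccess {p : ℕ} (hand : Fin p → Finset Card) (O : Finset (Card × Fin p)) : Prop :=
  ∃ lead L fin, PlaysFrom hand lead L fin ∧ Successful O L

theorem TrickOk.of_mem {p : ℕ} {st : Fin p → Finset Card} {lead : Fin p} {play : Fin p → Card}
    (hdisj : ∀ i j : Fin p, i ≠ j → Disjoint (st i) (st j))
    (hval : ∀ i : Fin p, ∀ c ∈ st i, c.1 = 1) (hplay : ∀ i, play i ∈ st i) :
    TrickOk st lead play := by
  refine ⟨fun i => ⟨_, hplay i⟩, hplay, fun i => ?_⟩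
  by_cases hi : i = lead
  · exact Or.inl (by rw [hi])
  · refine Or.inr fun c hc hs => Finset.disjoint_left.1 (hdisj i lead hi) hc ?_
    have h : c = play lead :=
      Prod.ext ((hval i c hc).trans (hval lead _ (hplay lead)).symm) hs
    exact h ▸ hplay lead

theorem Wins.lead_of_mem {p : ℕ} {st : Fin p → Finset Card} {lead : Fin p} {play : Fin p → Card}
    (hdisj : ∀ i j : Fin p, i ≠ j → Disjoint (st i) (st j))
    (hval : ∀ i : Fin p, ∀ c ∈ st i, c.1 = 1) (hplay : ∀ i, play i ∈ st i) :
    Wins lead play lead := by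
  refine ⟨rfl, fun j hj hs => ?_⟩
  have h : play j = play lead :=
    Prod.ext ((hval j _ (hplay j)).trans (hval lead _ (hplay lead)).symm) hs
  exact (Finset.disjoint_left.1 (hdisj j lead hj) (hplay j) (h ▸ hplay lead)).elim

theorem Wins.eq_lead {p : ℕ} {st : Fin p → Finset Card} {lead w : Fin p} {play : Fin p → Card}
    (hval : ∀ i : Fin p, ∀ c ∈ st i, c.1 = 1) (hplay : ∀ i, play i ∈ st i)
    (h : Wins lead play w) : w = lead := by
  by_contra hne
  have hlt := h.2 lead (Ne.symm hne) rfl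
  rw [hval _ _ (hplay lead), hval _ _ (hplay w)] at hlt
  exact lt_irrefl _ hlt

theorem nextState_subset {p : ℕ} (st : Fin p → Finset Card) (play : Fin p → Card) (i : Fin p) :
    nextState st play i ⊆ st i :=
  Finset.erase_subset _ _

theorem PlaysFrom.length_le_card {p : ℕ} {st fin : Fin p → Finset Card} {lead : Fin p}
    {L : List (Trick p)} (h : PlaysFrom st lead L fin) (j : Fin p) :
    L.length ≤ (st j).card := by
  induction h with
  | nil => simp
  | cons hok _ _ ih =>
    rw [nextState, Finset.card_erase_of_mem (hok.2.1 j)] at ih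
    have := Finset.card_pos.2 (hok.1 j)
    rw [List.length_cons]
    omega

theorem PlaysFrom.play_mem {p : ℕ} {st fin : Fin p → Finset Card} {lead : Fin p}
    {L : List (Trick p)} (h : PlaysFrom st lead L fin) :
    ∀ t ∈ L, ∀ j, t.play j ∈ st j := by
  induction h with
  | nil => simp
  | cons hok _ _ ih =>
    intro t ht j
    rcases List.mem_cons.1 ht with rfl | ht
    · exact hok.2.1 j
    · exact nextState_subset _ _ _ (ih t ht j)

/-- When all cards have the same value, the first leader wins every trick. -/
theorem PlaysFrom.winner_eq_lead {p : ℕ} {st fin : Fin p → Finset Card} {lead : Fin p}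
    {L : List (Trick p)} (h : PlaysFrom st lead L fin)
    (hval : ∀ i : Fin p, ∀ c ∈ st i, c.1 = 1) :
    ∀ t ∈ L, t.winner = lead := by
  induction h with
  | nil => simp
  | cons hok hw _ ih =>
    intro t ht
    have hwl := hw.eq_lead hval hok.2.1
    rcases List.mem_cons.1 ht with rfl | ht
    · exact hwl
    · exact (ih (fun i c hc => hval i c (nextState_subset _ _ _ hc)) t ht).trans hwl

/-- When all cards have value 1, any leader can win the play of all cards in chosen sets `S i`,
as long as no `S i` is larger than some hand. -/
theorem exists_playsFrom_covering {p : ℕ} (lead : Fin p) (n : ℕ) (st S : Fin p → Finset Card)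
    (hdisj : ∀ i j : Fin p, i ≠ j → Disjoint (st i) (st j))
    (hval : ∀ i : Fin p, ∀ c ∈ st i, c.1 = 1)
    (hS : ∀ i, S i ⊆ st i) (hSn : ∀ i, (S i).card ≤ n) (hn : ∀ i, n ≤ (st i).card) :
    ∃ L fin, PlaysFrom st lead L fin ∧
      ∀ i, ∀ c ∈ S i, ∃ t ∈ L, t.play i = c ∧ t.winner = lead := by
  induction n generalizing st S with
  | zero =>
    refine ⟨[], st, .nil st lead, fun i c hc => ?_⟩
    have := Finset.card_pos.2 ⟨c, hc⟩
    have := hSn i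
    omega
  | succ n ih =>
    have hex : ∀ i, ∃ c ∈ st i, (S i).Nonempty → c ∈ S i := by
      intro i
      rcases (S i).eq_empty_or_nonempty with he | ⟨c, hc⟩
      · obtain ⟨c, hc⟩ := Finset.card_pos.1 (n.succ_pos.trans_le (hn i))
        exact ⟨c, hc, fun h => (h.ne_empty he).elim⟩
      · exact ⟨c, hS i hc, fun _ => hc⟩
    choose play hplay hplayS using hex
    obtain ⟨L, fin, hL, hcov⟩ := ih (nextState st play) (fun i => (S i).erase (play i))
      (fun i j hij => (hdisj i j hij).mono (nextState_subset _ _ _) (nextState_subset _ _ _))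
      (fun i c hc => hval i c (nextState_subset _ _ _ hc))
      (fun i => Finset.erase_subset_erase _ (hS i))
      (fun i => by
        rcases (S i).eq_empty_or_nonempty with he | hne
        · simp [he]
        · rw [Finset.card_erase_of_mem (hplayS i hne)]
          have := hSn i
          omega)
      (fun i => by
        rw [nextState, Finset.card_erase_of_mem (hplay i)]
        have := hn i
        omega)
    refine ⟨_, fin, .cons (.of_mem hdisj hval hplay) (.lead_of_mem hdisj hval hplay) hL,
      fun i c hc => ?_⟩
    by_cases hcp : c = play i
    · exact ⟨_, List.mem_cons_self, hcp.symm, rfl⟩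
    · obtain ⟨t, ht, h⟩ := hcov i c (Finset.mem_erase.2 ⟨hcp, hc⟩)
      exact ⟨t, List.mem_cons_of_mem _ ht, h⟩

/-- A Crew instance in which every card has value 1 (k = 1) admits a
successful play sequence iff either there are no objectives, or all objectives
belong to a single player and the minimum hand size is at least the maximum,
over players, of the number of objective cards held. -/
theorem crew_single_value_characterization {p : ℕ} (hp : 2 ≤ p)
    (hand : Fin p → Finset Card) (O : Finset (Card × Fin p))
    (hvalid : ValidInstance hand O)
    (hval : ∀ i : Fin p, ∀ c ∈ hand i, c.1 = 1) :
    HasSuccess hand O ↔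
      O = ∅ ∨
        ∃ i : Fin p, (∀ o ∈ O, o.2 = i) ∧
          ∀ j j' : Fin p,
            ((hand j').filter (fun c => c ∈ O.image Prod.fst)).card ≤ (hand j).card := by
  constructor
  · rintro ⟨lead, L, fin, hL, hsucc⟩
    refine Or.inr ⟨lead, fun o ho => ?_, fun j j' => ?_⟩
    · obtain ⟨t, ht, -, hw⟩ := hsucc o ho
      exact hw.symm.trans (hL.winner_eq_lead hval t ht)
    · refine le_trans ?_ (hL.length_le_card j)
      have hsub : (hand j').filter (fun c => c ∈ O.image Prod.fst) ⊆
          (L.map fun t => t.play j').toFinset := by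
        intro c hc
        obtain ⟨hcj, hcO⟩ := Finset.mem_filter.1 hc
        obtain ⟨o, ho, rfl⟩ := Finset.mem_image.1 hcO
        obtain ⟨t, ht, ⟨k, hk⟩, -⟩ := hsucc o ho
        have hkj : k = j' := by
          by_contra hne
          exact Finset.disjoint_left.1 (hvalid.1 k j' hne) (hL.play_mem t ht k) (hk ▸ hcj)
        exact List.mem_toFinset.2 (List.mem_map.2 ⟨t, ht, hkj ▸ hk⟩)
      calc _ ≤ _ := Finset.card_le_card hsub
        _ ≤ _ := List.toFinset_card_le _
        _ = L.length := List.length_map _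
  · rintro (rfl | ⟨i, hi, hcard⟩)
    · exact ⟨⟨0, by omega⟩, [], hand, .nil _ _, by simp [Successful]⟩
    · obtain ⟨L, fin, hL, hcov⟩ := exists_playsFrom_covering i
        (Finset.univ.sup fun j => ((hand j).filter (fun c => c ∈ O.image Prod.fst)).card) hand
        (fun j => (hand j).filter (fun c => c ∈ O.image Prod.fst)) hvalid.1 hval
        (fun j => Finset.filter_subset _ _)
        (fun j => Finset.le_sup
          (f := fun j => ((hand j).filter (fun c => c ∈ O.image Prod.fst)).card)
          (Finset.mem_univ j))
        (fun j => Finset.sup_le fun j' _ => hcard j j')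
      refine ⟨i, L, fin, hL, fun o ho => ?_⟩
      obtain ⟨j, hj⟩ := hvalid.2.1 o ho
      obtain ⟨t, ht, hp, hw⟩ :=
        hcov j o.1 (Finset.mem_filter.2 ⟨hj, Finset.mem_image_of_mem _ ho⟩)
      exact ⟨t, ht, ⟨j, hp⟩, hw.trans (hi o ho).symm⟩
end

section
/- Let G be a finite simple undirected graph on vertex set {1, …, m} with m ≥ 2, and let I(G) be the Crew instance associated to G by the reduction. Then G contains a Hamiltonian path if and only if I(G) admits a successful play sequence. -/
/-- The hand dealt to player `j` by the reduction from a graph `G`: for each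
neighbor `i` of `j`, the card `(f i j, suit i)`; the card
`(deg j + 1, suit j)`; and the junk cards of `j`. -/
def reductionHand {m : ℕ} (G : SimpleGraph (Fin m)) [DecidableRel G.Adj]
    (f : Fin m → Fin m → ℕ) (junk : Fin m → Finset Card) : Fin m → Finset Card :=
  fun j =>
    (G.neighborFinset j).image (fun i => (f i j, (i : ℕ))) ∪
      {((G.degree j + 1 : ℕ), (j : ℕ))} ∪ junk j

/-- The objectives of the reduction: player `j` must win the card
`(deg j + 1, suit j)`. -/
def reductionObjs {m : ℕ} (G : SimpleGraph (Fin m)) [DecidableRel G.Adj] :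
    Finset (Card × Fin m) :=
  Finset.univ.image (fun j => (((G.degree j + 1 : ℕ), (j : ℕ)), j))

namespace PlaysFrom

variable {p : ℕ} {st fin : Fin p → Finset Card} {lead : Fin p} {L : List (Trick p)}

lemma length_le_card_s11 (h : PlaysFrom st lead L fin) (i : Fin p) : L.length ≤ (st i).card := by
  induction h with
  | nil => simp
  | cons hok _ _ ih =>
    have hcard := Finset.card_erase_add_one (hok.2.1 i)
    simp only [nextState] at ih
    simp only [List.length_cons]
    omega

lemma play_mem_s11 (h : PlaysFrom st lead L fin) {t : Trick p} (ht : t ∈ L) (i : Fin p) :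
    t.play i ∈ st i := by
  induction h with
  | nil => simp at ht
  | cons hok _ _ ih =>
    rcases List.mem_cons.mp ht with rfl | ht
    · exact hok.2.1 i
    · exact Finset.mem_of_mem_erase (ih ht)

lemma wins (h : PlaysFrom st lead L fin) {t : Trick p} (ht : t ∈ L) :
    Wins t.lead t.play t.winner := by
  induction h with
  | nil => simp at ht
  | cons _ hw _ ih =>
    rcases List.mem_cons.mp ht with rfl | ht
    · exact hw
    · exact ih ht

lemma isChain_cons (h : PlaysFrom st lead L fin) (t₀ : Trick p) (h₀ : t₀.winner = lead) :
    (t₀ :: L).IsChain (fun s t => s.winner = t.lead) := by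
  induction h generalizing t₀ with
  | nil => simp
  | cons _ _ _ ih => exact List.isChain_cons_cons.mpr ⟨h₀, ih _ rfl⟩

lemma isChain (h : PlaysFrom st lead L fin) :
    L.IsChain (fun s t => s.winner = t.lead) := by
  cases h with
  | nil => simp
  | cons _ _ h => exact h.isChain_cons _ rfl

end PlaysFrom

section Reduction

variable {m : ℕ} {G : SimpleGraph (Fin m)} [DecidableRel G.Adj]
  {f : Fin m → Fin m → ℕ} {junk : Fin m → Finset Card}

lemma mem_reductionHand {j : Fin m} {c : Card} :
    c ∈ reductionHand G f junk j ↔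
      (∃ i, G.Adj j i ∧ (f i j, (i : ℕ)) = c) ∨ c = (G.degree j + 1, (j : ℕ)) ∨ c ∈ junk j := by
  simp [reductionHand, or_left_comm]

lemma card_reductionHand_le (hjcard : ∀ i, (junk i).card = m - G.degree i - 1) (j : Fin m) :
    (reductionHand G f junk j).card ≤ m := by
  have hdeg : G.degree j < m := by simpa using G.degree_lt_card_verts j
  have himage : ((G.neighborFinset j).image fun i => (f i j, (i : ℕ))).card ≤ G.degree j :=
    Finset.card_image_le.trans_eq (G.card_neighborFinset_eq_degree j)
  have hunion := Finset.card_union_le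
    ((G.neighborFinset j).image fun i => (f i j, (i : ℕ))) {(G.degree j + 1, (j : ℕ))}
  have htotal := Finset.card_union_le
    ((G.neighborFinset j).image (fun i => (f i j, (i : ℕ))) ∪ {(G.degree j + 1, (j : ℕ))}) (junk j)
  have hjunk := hjcard j
  rw [Finset.card_singleton] at hunion
  unfold reductionHand
  omega

lemma eq_or_adj_of_mem_reductionHand (hjsuit : ∀ i : Fin m, ∀ c ∈ junk i, m ≤ c.2)
    {j v : Fin m} {c : Card} (hc : c ∈ reductionHand G f junk j) (hv : c.2 = v) :
    j = v ∨ G.Adj j v := by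
  rcases mem_reductionHand.mp hc with ⟨i, hi, rfl⟩ | rfl | hc
  · exact .inr (Fin.ext hv ▸ hi)
  · exact .inl (Fin.ext hv)
  · have := hjsuit j c hc
    omega

lemma value_le_degree
    (hf_img : ∀ i : Fin m, (G.neighborFinset i).image (f i) = Finset.Icc 1 (G.degree i))
    {i j : Fin m} (h : G.Adj i j) : f i j ≤ G.degree i := by
  have : f i j ∈ Finset.Icc 1 (G.degree i) :=
    hf_img i ▸ Finset.mem_image_of_mem _ (by simpa using h)
  exact (Finset.mem_Icc.mp this).2

lemma eq_of_objective_mem_reductionHand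
    (hf_img : ∀ i : Fin m, (G.neighborFinset i).image (f i) = Finset.Icc 1 (G.degree i))
    (hjsuit : ∀ i : Fin m, ∀ c ∈ junk i, m ≤ c.2) {i j : Fin m}
    (h : (G.degree i + 1, (i : ℕ)) ∈ reductionHand G f junk j) : j = i := by
  rcases mem_reductionHand.mp h with ⟨v, hv, heq⟩ | heq | hc
  · obtain ⟨hval, hsuit⟩ := Prod.mk.inj heq
    obtain rfl := Fin.ext hsuit
    have := value_le_degree hf_img hv.symm
    omega
  · exact Fin.ext (Prod.mk.inj heq).2.symm
  · have := hjsuit j _ hc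
    simp only at this
    omega

/-- In a successful play of the reduction every player wins exactly one trick, and the list of
winners is a Hamiltonian path. -/
lemma exists_isHamiltonian_of_successful
    (hf_img : ∀ i : Fin m, (G.neighborFinset i).image (f i) = Finset.Icc 1 (G.degree i))
    (hjcard : ∀ i, (junk i).card = m - G.degree i - 1)
    (hjsuit : ∀ i : Fin m, ∀ c ∈ junk i, m ≤ c.2)
    {lead : Fin m} {L : List (Trick m)} {fin : Fin m → Finset Card}
    (hplay : PlaysFrom (reductionHand G f junk) lead L fin)
    (hsucc : Successful (reductionObjs G) L) :
    ∃ (a b : Fin m) (w : G.Walk a b), w.IsHamiltonian := by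
  have hwin (i : Fin m) : ∃ t ∈ L, Completes t ((G.degree i + 1, (i : ℕ)), i) :=
    hsucc _ (Finset.mem_image_of_mem _ (Finset.mem_univ i))
  have hmem (i : Fin m) : i ∈ L.map Trick.winner := by
    obtain ⟨t, ht, -, hi⟩ := hwin i
    exact List.mem_map.mpr ⟨t, ht, hi⟩
  have hnodup : (L.map Trick.winner).Nodup := by
    have huniv : (L.map Trick.winner).toFinset = Finset.univ := by
      ext i
      simpa using hmem i
    have hcard := List.card_toFinset (L.map Trick.winner)
    rw [huniv, Finset.card_univ, Fintype.card_fin] at hcard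
    rw [← List.dedup_eq_self]
    refine (List.dedup_sublist _).eq_of_length_le ?_
    rw [← hcard, List.length_map]
    exact (hplay.length_le_card_s11 lead).trans (card_reductionHand_le hjcard lead)
  have hsuit (t : Trick m) (ht : t ∈ L) : (t.play t.lead).2 = t.winner := by
    obtain ⟨t', ht', ⟨j, hj⟩, hwinner⟩ := hwin t.winner
    obtain rfl := List.inj_on_of_nodup_map hnodup ht' ht hwinner
    obtain rfl := eq_of_objective_mem_reductionHand hf_img hjsuit (hj ▸ hplay.play_mem_s11 ht j)
    rw [← (hplay.wins ht).1, hj]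
  have hchain : (L.map Trick.winner).IsChain G.Adj := by
    have hlead := hplay.isChain
    rw [List.isChain_iff_getElem] at hlead ⊢
    intro k hk
    rw [List.length_map] at hk
    rw [List.getElem_map, List.getElem_map]
    have hmemHand := hplay.play_mem_s11 (List.getElem_mem hk) L[k + 1].lead
    rcases eq_or_adj_of_mem_reductionHand hjsuit hmemHand (hsuit _ (List.getElem_mem hk))
      with heq | hadj
    · rw [← hlead k hk] at heq
      have := (hnodup.getElem_inj_iff (i := k) (j := k + 1) (hi := by simp; omega)
        (hj := by simpa using hk)).mp (by simpa using heq)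
      omega
    · rwa [hlead k hk]
  have hne : L.map Trick.winner ≠ [] := List.ne_nil_of_mem (hmem lead)
  have hsupport := SimpleGraph.Walk.support_ofSupport hne hchain
  refine ⟨_, _, .ofSupport _ hne hchain, ?_⟩
  exact (SimpleGraph.Walk.IsPath.mk' (by rwa [hsupport])).isHamiltonian_of_mem
    fun i => by rw [hsupport]; exact hmem i

/-- A schedule for player `i`, telling which card to play in the trick of suit `v`: it uses each
card of the hand exactly once and follows suit. -/
structure IsSchedule (G : SimpleGraph (Fin m)) [DecidableRel G.Adj] (f : Fin m → Fin m → ℕ)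
    (junk : Fin m → Finset Card) (i : Fin m) (c : Fin m → Card) : Prop where
  injective : Function.Injective c
  image_univ : Finset.univ.image c = reductionHand G f junk i
  self : c i = (G.degree i + 1, (i : ℕ))
  adj : ∀ v, G.Adj i v → c v = (f v i, (v : ℕ))
  not_adj : ∀ v, i ≠ v → ¬G.Adj i v → m ≤ (c v).2

lemma exists_isSchedule (hjcard : ∀ i, (junk i).card = m - G.degree i - 1)
    (hjsuit : ∀ i : Fin m, ∀ c ∈ junk i, m ≤ c.2) (i : Fin m) :
    ∃ c, IsSchedule G f junk i c := by
  have hcard : (Gᶜ.neighborFinset i).card = (junk i).card := by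
    rw [SimpleGraph.card_neighborFinset_eq_degree, SimpleGraph.degree_compl, Fintype.card_fin,
      hjcard, Nat.sub_right_comm]
  let e := Finset.equivOfCardEq hcard
  have hcompl {v : Fin m} : v ∈ Gᶜ.neighborFinset i ↔ i ≠ v ∧ ¬G.Adj i v := by
    rw [SimpleGraph.mem_neighborFinset, SimpleGraph.compl_adj]
  let c (v : Fin m) : Card :=
    if h : v ∈ Gᶜ.neighborFinset i then (e ⟨v, h⟩ : Card)
    else if i = v then (G.degree i + 1, (v : ℕ)) else (f v i, (v : ℕ))
  have hc_mem {v : Fin m} (h : v ∈ Gᶜ.neighborFinset i) : c v = (e ⟨v, h⟩ : Card) := dif_pos h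
  have hc_suit {v : Fin m} (h : v ∉ Gᶜ.neighborFinset i) : (c v).2 = v := by
    simp only [c, dif_neg h]
    split <;> rfl
  have hself : c i = (G.degree i + 1, (i : ℕ)) := by simp [c]
  have hadj (v : Fin m) (h : G.Adj i v) : c v = (f v i, (v : ℕ)) := by
    simp [c, h, h.ne]
  have hjunk {v : Fin m} (h : v ∈ Gᶜ.neighborFinset i) : c v ∈ junk i := by
    rw [hc_mem h]
    exact (e ⟨v, h⟩).2
  have hlarge {v : Fin m} (h : v ∈ Gᶜ.neighborFinset i) : m ≤ (c v).2 := hjsuit i _ (hjunk h)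
  refine ⟨c, fun u v huv => ?_, ?_, hself, hadj, fun v hne hv => hlarge (hcompl.mpr ⟨hne, hv⟩)⟩
  · by_cases hu : u ∈ Gᶜ.neighborFinset i <;> by_cases hv : v ∈ Gᶜ.neighborFinset i
    · rw [hc_mem hu, hc_mem hv] at huv
      exact congrArg Subtype.val (e.injective (Subtype.ext huv))
    · have := hlarge hu
      rw [huv, hc_suit hv] at this
      omega
    · have := hlarge hv
      rw [← huv, hc_suit hu] at this
      omega
    · exact Fin.ext (by rw [← hc_suit hu, ← hc_suit hv, huv])
  · ext x
    simp only [Finset.mem_image, Finset.mem_univ, true_and, mem_reductionHand]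
    constructor
    · rintro ⟨v, rfl⟩
      by_cases hv : v ∈ Gᶜ.neighborFinset i
      · exact .inr (.inr (hjunk hv))
      · by_cases hiv : i = v
        · subst hiv
          exact .inr (.inl hself)
        · have h : G.Adj i v := by simpa [hcompl, hiv] using hv
          exact .inl ⟨v, h, (hadj v h).symm⟩
    · rintro (⟨v, hv, rfl⟩ | rfl | hx)
      · exact ⟨v, hadj v hv⟩
      · exact ⟨i, hself⟩
      · obtain ⟨v, hv⟩ := e.surjective ⟨x, hx⟩
        exact ⟨v, by rw [hc_mem v.2, hv]⟩

namespace IsSchedule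

variable {c : Fin m → Fin m → Card}

lemma suit_eq (hc : ∀ i, IsSchedule G f junk i (c i)) {i v : Fin m} (h : i = v ∨ G.Adj i v) :
    (c i v).2 = v := by
  rcases h with rfl | h
  · rw [(hc i).self]
  · rw [(hc i).adj v h]

lemma eq_or_adj_and_eq (hc : ∀ i, IsSchedule G f junk i (c i)) {i u v : Fin m}
    (h : (c i u).2 = v) : (i = v ∨ G.Adj i v) ∧ u = v := by
  by_cases hu : i = u ∨ G.Adj i u
  · obtain rfl : u = v := Fin.ext ((suit_eq hc hu).symm.trans h)
    exact ⟨hu, rfl⟩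
  · rw [not_or] at hu
    have := (hc i).not_adj u hu.1 hu.2
    omega

lemma wins
    (hf_img : ∀ i : Fin m, (G.neighborFinset i).image (f i) = Finset.Icc 1 (G.degree i))
    (hc : ∀ i, IsSchedule G f junk i (c i)) {lead v : Fin m} (h : lead = v ∨ G.Adj lead v) :
    Wins lead (fun i => c i v) v := by
  simp only [Wins, suit_eq hc h]
  refine ⟨suit_eq hc (.inl rfl), fun j hj hsuit => ?_⟩
  have hadj := (eq_or_adj_and_eq hc hsuit).1.resolve_left hj
  rw [(hc v).self, (hc j).adj v hadj]
  exact Nat.lt_succ_of_le (value_le_degree hf_img hadj.symm)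

lemma trickOk (hc : ∀ i, IsSchedule G f junk i (c i)) {lead v : Fin m}
    (h : lead = v ∨ G.Adj lead v) {s : Finset (Fin m)} (hv : v ∈ s) :
    TrickOk (fun i => s.image (c i)) lead (fun i => c i v) := by
  refine ⟨fun i => ⟨_, Finset.mem_image_of_mem _ hv⟩, fun i => Finset.mem_image_of_mem _ hv,
    fun i => ?_⟩
  rw [suit_eq hc h]
  by_cases hi : i = v ∨ G.Adj i v
  · exact .inl (suit_eq hc hi)
  · refine .inr fun x hx hsuit => ?_
    obtain ⟨u, -, rfl⟩ := Finset.mem_image.mp hx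
    exact hi (eq_or_adj_and_eq hc hsuit).1

lemma exists_playsFrom
    (hf_img : ∀ i : Fin m, (G.neighborFinset i).image (f i) = Finset.Icc 1 (G.degree i))
    (hc : ∀ i, IsSchedule G f junk i (c i)) (l : List (Fin m)) (hl : l.Nodup)
    (hchain : l.IsChain G.Adj) (lead : Fin m) (hlead : ∀ v ∈ l.head?, lead = v ∨ G.Adj lead v) :
    ∃ L fin, PlaysFrom (fun i => l.toFinset.image (c i)) lead L fin ∧
      ∀ v ∈ l, ∃ t ∈ L, t.play v = c v v ∧ t.winner = v := by
  induction l generalizing lead with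
  | nil => exact ⟨[], _, .nil _ _, by simp⟩
  | cons v l ih =>
    have hv := hlead v rfl
    rw [List.nodup_cons] at hl
    rw [List.isChain_cons] at hchain
    obtain ⟨L, fin, hplay, hwin⟩ := ih hl.2 hchain.2 v fun u hu => .inr (hchain.1 u hu)
    have hnext : nextState (fun i => (v :: l).toFinset.image (c i)) (fun i => c i v) =
        fun i => l.toFinset.image (c i) := by
      funext i
      rw [nextState, ← Finset.image_erase (hc i).injective, List.toFinset_cons,
        Finset.erase_insert (by simpa using hl.1)]
    refine ⟨⟨lead, fun i => c i v, v⟩ :: L, fin,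
      .cons (trickOk hc hv (by simp)) (wins hf_img hc hv) (hnext ▸ hplay), fun u hu => ?_⟩
    rcases List.mem_cons.mp hu with rfl | hu
    · exact ⟨_, List.mem_cons_self, rfl, rfl⟩
    · obtain ⟨t, ht, h⟩ := hwin u hu
      exact ⟨t, List.mem_cons_of_mem _ ht, h⟩

end IsSchedule

lemma hasSuccess_of_isHamiltonian
    (hf_img : ∀ i : Fin m, (G.neighborFinset i).image (f i) = Finset.Icc 1 (G.degree i))
    (hjcard : ∀ i, (junk i).card = m - G.degree i - 1)
    (hjsuit : ∀ i : Fin m, ∀ c ∈ junk i, m ≤ c.2)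
    {a b : Fin m} {w : G.Walk a b} (hw : w.IsHamiltonian) :
    HasSuccess (reductionHand G f junk) (reductionObjs G) := by
  choose c hc using exists_isSchedule (G := G) (f := f) hjcard hjsuit
  obtain ⟨L, fin, hplay, hwin⟩ := IsSchedule.exists_playsFrom hf_img hc w.support
    hw.isPath.support_nodup w.isChain_adj_support a fun v hv => by
      rw [← SimpleGraph.Walk.cons_tail_support] at hv
      exact .inl (Option.mem_some_iff.mp hv)
  rw [hw.toFinset_support, funext fun i => (hc i).image_univ] at hplay
  refine ⟨a, L, fin, hplay, fun o ho => ?_⟩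
  obtain ⟨j, -, rfl⟩ := Finset.mem_image.mp ho
  obtain ⟨t, ht, htplay, htwin⟩ := hwin j (hw.mem_support j)
  exact ⟨t, ht, ⟨j, htplay.trans (hc j).self⟩, htwin⟩

end Reduction

/-- G has a Hamiltonian path iff the Crew instance I(G) produced
by the reduction admits a successful play sequence. -/
theorem hamiltonianPath_iff_crew_success {m : ℕ} (hm : 2 ≤ m)
    (G : SimpleGraph (Fin m)) [DecidableRel G.Adj]
    (f : Fin m → Fin m → ℕ)
    (hf_inj : ∀ i : Fin m, Set.InjOn (f i) (G.neighborFinset i))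
    (hf_img : ∀ i : Fin m, (G.neighborFinset i).image (f i) = Finset.Icc 1 (G.degree i))
    (junk : Fin m → Finset Card)
    (hjcard : ∀ i, (junk i).card = m - G.degree i - 1)
    (hjsuit : ∀ i : Fin m, ∀ c ∈ junk i, m ≤ c.2)
    (hjdist : ∀ (i i' : Fin m) (c c' : Card), c ∈ junk i → c' ∈ junk i' →
      c.2 = c'.2 → i = i' ∧ c = c') :
    (∃ (a b : Fin m) (w : G.Walk a b), w.IsHamiltonian) ↔
      HasSuccess (reductionHand G f junk) (reductionObjs G) := by
  exact ⟨fun ⟨_, _, _, hw⟩ => hasSuccess_of_isHamiltonian hf_img hjcard hjsuit hw,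
    fun ⟨_, _, _, hplay, hsucc⟩ =>
      exists_isHamiltonian_of_successful hf_img hjcard hjsuit hplay hsucc⟩
end
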